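/- arXiv:1004.3459 — 2 statements merged into one kernel-verified Lean document; each statement's English description precedes it below -/
import Mathlib

section
/- Let g : ℝ → ℝ be continuously differentiable, and let u⁺ < u⁻ be real numbers with g(u⁺) = g(u⁻) = 0 and g(v) < 0 for every v ∈ (u⁺, u⁻). Then there exists a continuously differentiable function V : ℝ → ℝ such that V'(ξ) = g(V(ξ)) for all ξ ∈ ℝ, V is strictly decreasing, V(ξ) → u⁻ as ξ → −∞, and V(ξ) → u⁺ as ξ → +∞. -/
open Filter

/-- Existence of a strictly decreasing heteroclinic (viscous shock profile) for the
scalar autonomous ODE `V' = g(V)` connecting `u⁻` at `-∞` to `u⁺` at `+∞`. -/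
theorem exists_scalar_viscous_profile (g : ℝ → ℝ) (hg : ContDiff ℝ 1 g)
    (uplus uminus : ℝ) (hlt : uplus < uminus)
    (hgp : g uplus = 0) (hgm : g uminus = 0)
    (hneg : ∀ v ∈ Set.Ioo uplus uminus, g v < 0) :
    ∃ V : ℝ → ℝ, ContDiff ℝ 1 V ∧ (∀ ξ : ℝ, deriv V ξ = g (V ξ)) ∧
      StrictAnti V ∧ Tendsto V atBot (nhds uminus) ∧ Tendsto V atTop (nhds uplus) := by
  have hgc : Continuous g := hg.continuous
  have hgd : Differentiable ℝ g := hg.differentiable (by norm_num)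
  -- Lipschitz constant
  obtain ⟨K, hK0, hK⟩ : ∃ K : ℝ, 0 < K ∧ ∀ x ∈ Set.Icc uplus uminus,
      ∀ y ∈ Set.Icc uplus uminus, |g y - g x| ≤ K * |y - x| := by
    obtain ⟨C, hC⟩ := (isCompact_Icc (a := uplus) (b := uminus)).exists_bound_of_continuousOn
      (hg.continuous_deriv (by norm_num)).continuousOn
    refine ⟨max C 1, by positivity, fun x hx y hy => ?_⟩
    exact (convex_Icc uplus uminus).norm_image_sub_le_of_norm_deriv_le
      (fun z _ => hgd z) (fun z hz => (hC z hz).trans (le_max_left _ _)) hx hy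
  obtain ⟨m, hm⟩ := exists_between hlt
  have hmI : m ∈ Set.Ioo uplus uminus := hm
  obtain ⟨T, hT⟩ : ∃ T : ℝ → ℝ, ∀ v ∈ Set.Ioo uplus uminus, HasDerivAt T (g v)⁻¹ v := by
    refine ⟨fun v => ∫ x in m..v, (g x)⁻¹, fun v hv => ?_⟩
    apply intervalIntegral.integral_hasDerivAt_right
    · apply ContinuousOn.intervalIntegrable
      apply hgc.continuousOn.inv₀
      intro x hx
      exact (hneg x (Set.ordConnected_Ioo.uIcc_subset hmI hv hx)).ne
    · exact hgc.measurable.inv.stronglyMeasurable.stronglyMeasurableAtFilter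
    · exact hgc.continuousAt.inv₀ (hneg v hv).ne
  have hTc : ContinuousOn T (Set.Ioo uplus uminus) :=
    fun v hv => (hT v hv).continuousAt.continuousWithinAt
  have hTanti : StrictAntiOn T (Set.Ioo uplus uminus) := by
    apply strictAntiOn_of_deriv_neg (convex_Ioo _ _) hTc
    intro v hv
    rw [interior_Ioo] at hv
    rw [(hT v hv).deriv]
    exact inv_lt_zero.2 (hneg v hv)
  have hup : ∀ ξ, ∃ v ∈ Set.Ioo uplus uminus, ξ < T v := by
    intro ξ
    have hd : ∀ v ∈ Set.Ioo uplus uminus,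
        HasDerivAt (fun v => T v + K⁻¹ * Real.log (v - uplus))
          ((g v)⁻¹ + K⁻¹ * (1 / (v - uplus))) v := by
      intro v hv
      exact (hT v hv).add ((((hasDerivAt_id v).sub_const uplus).log
        (sub_pos.2 hv.1).ne').const_mul K⁻¹)
    have hL : AntitoneOn (fun v => T v + K⁻¹ * Real.log (v - uplus))
        (Set.Ioo uplus uminus) := by
      apply antitoneOn_of_deriv_nonpos (convex_Ioo _ _)
      · exact fun v hv => (hd v hv).continuousAt.continuousWithinAt
      · rw [interior_Ioo]
        exact fun v hv => (hd v hv).differentiableAt.differentiableWithinAt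
      · rw [interior_Ioo]
        intro v hv
        rw [(hd v hv).deriv]
        have h1 := hK uplus ⟨le_rfl, hlt.le⟩ v ⟨hv.1.le, hv.2.le⟩
        rw [hgp, sub_zero, abs_of_neg (hneg v hv), abs_of_pos (sub_pos.2 hv.1)] at h1
        have h2 := one_div_le_one_div_of_le (neg_pos.2 (hneg v hv)) h1
        rw [one_div, one_div, inv_neg, mul_inv] at h2
        rw [one_div]
        linarith
    set Q := T m + K⁻¹ * Real.log (m - uplus) with hQ
    set d := min (m - uplus) (Real.exp (K * (Q - ξ) - 1)) with hdd
    have hd0 : 0 < d := lt_min (sub_pos.2 hm.1) (Real.exp_pos _)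
    have hdm : d ≤ m - uplus := min_le_left _ _
    have hmem : uplus + d ∈ Set.Ioo uplus uminus := ⟨by linarith, by linarith [hm.2]⟩
    refine ⟨uplus + d, hmem, ?_⟩
    have h1 := hL hmem hmI (by linarith)
    simp only [add_sub_cancel_left] at h1
    have h2 : Real.log d ≤ K * (Q - ξ) - 1 := by
      rw [Real.log_le_iff_le_exp hd0]; exact min_le_right _ _
    have h3 : K⁻¹ * Real.log d < Q - ξ := by
      rw [inv_mul_lt_iff₀ hK0]; linarith
    linarith
  have hdown : ∀ ξ, ∃ v ∈ Set.Ioo uplus uminus, T v < ξ := by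
    intro ξ
    have hd : ∀ v ∈ Set.Ioo uplus uminus,
        HasDerivAt (fun v => T v - K⁻¹ * Real.log (uminus - v))
          ((g v)⁻¹ - K⁻¹ * (-1 / (uminus - v))) v := by
      intro v hv
      exact (hT v hv).sub ((((hasDerivAt_id v).const_sub uminus).log
        (sub_pos.2 hv.2).ne').const_mul K⁻¹)
    have hL : AntitoneOn (fun v => T v - K⁻¹ * Real.log (uminus - v))
        (Set.Ioo uplus uminus) := by
      apply antitoneOn_of_deriv_nonpos (convex_Ioo _ _)
      · exact fun v hv => (hd v hv).continuousAt.continuousWithinAt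
      · rw [interior_Ioo]
        exact fun v hv => (hd v hv).differentiableAt.differentiableWithinAt
      · rw [interior_Ioo]
        intro v hv
        rw [(hd v hv).deriv]
        have h1 := hK uminus ⟨hlt.le, le_rfl⟩ v ⟨hv.1.le, hv.2.le⟩
        rw [hgm, sub_zero, abs_of_neg (hneg v hv), abs_of_neg (sub_neg.2 hv.2), neg_sub] at h1
        have h2 := one_div_le_one_div_of_le (neg_pos.2 (hneg v hv)) h1
        rw [one_div, one_div, inv_neg, mul_inv] at h2
        rw [neg_div, one_div]
        linarith
    set Q := T m - K⁻¹ * Real.log (uminus - m) with hQ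
    set d := min (uminus - m) (Real.exp (K * (ξ - Q) - 1)) with hdd
    have hd0 : 0 < d := lt_min (sub_pos.2 hm.2) (Real.exp_pos _)
    have hdm : d ≤ uminus - m := min_le_left _ _
    have hmem : uminus - d ∈ Set.Ioo uplus uminus := ⟨by linarith [hm.1], by linarith⟩
    refine ⟨uminus - d, hmem, ?_⟩
    have h1 := hL hmI hmem (by linarith)
    simp only [sub_sub_cancel] at h1
    have h2 : Real.log d ≤ K * (ξ - Q) - 1 := by
      rw [Real.log_le_iff_le_exp hd0]; exact min_le_right _ _
    have h3 : K⁻¹ * Real.log d < ξ - Q := by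
      rw [inv_mul_lt_iff₀ hK0]; linarith
    linarith
  have hsurj : ∀ ξ, ∃ v ∈ Set.Ioo uplus uminus, T v = ξ := by
    intro ξ
    obtain ⟨v, hv, hv'⟩ := hdown ξ
    obtain ⟨w, hw, hw'⟩ := hup ξ
    exact isPreconnected_Ioo.intermediate_value hv hw hTc ⟨hv'.le, hw'.le⟩
  choose V hV hTV using hsurj
  have hlow : ∀ v ∈ Set.Ioo uplus uminus, ∀ ξ, ξ < T v → v < V ξ := by
    intro v hv ξ h
    rw [← hTV ξ] at h
    exact (hTanti.lt_iff_gt (hV ξ) hv).1 h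
  have hhigh : ∀ v ∈ Set.Ioo uplus uminus, ∀ ξ, T v < ξ → V ξ < v := by
    intro v hv ξ h
    rw [← hTV ξ] at h
    exact (hTanti.lt_iff_gt hv (hV ξ)).1 h
  have hVc : Continuous V := by
    rw [continuous_iff_continuousAt]
    intro ξ
    refine tendsto_order.2 ⟨fun c hc => ?_, fun c hc => ?_⟩
    · obtain ⟨v, hv1, hv2⟩ := exists_between (max_lt hc (hV ξ).1)
      have hv : v ∈ Set.Ioo uplus uminus :=
        ⟨(le_max_right _ _).trans_lt hv1, hv2.trans (hV ξ).2⟩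
      have : ξ < T v := by
        rw [← hTV ξ]; exact hTanti hv (hV ξ) hv2
      filter_upwards [Iio_mem_nhds this] with η hη
      exact ((le_max_left _ _).trans_lt hv1).trans (hlow v hv η hη)
    · obtain ⟨v, hv1, hv2⟩ := exists_between (lt_min hc (hV ξ).2)
      have hv : v ∈ Set.Ioo uplus uminus :=
        ⟨(hV ξ).1.trans hv1, hv2.trans_le (min_le_right _ _)⟩
      have : T v < ξ := by
        rw [← hTV ξ]; exact hTanti (hV ξ) hv hv1
      filter_upwards [Ioi_mem_nhds this] with η hη
      exact (hhigh v hv η hη).trans (hv2.trans_le (min_le_left _ _))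
  have hVd : ∀ ξ, HasDerivAt V (g (V ξ)) ξ := by
    intro ξ
    have h := HasDerivAt.of_local_left_inverse hVc.continuousAt (hT (V ξ) (hV ξ))
      (inv_ne_zero (hneg _ (hV ξ)).ne) (Eventually.of_forall hTV)
    rwa [inv_inv] at h
  have hder : deriv V = fun ξ => g (V ξ) := funext fun ξ => (hVd ξ).deriv
  refine ⟨V, ?_, fun ξ => (hVd ξ).deriv, ?_, ?_, ?_⟩
  · rw [contDiff_one_iff_deriv]
    exact ⟨fun ξ => (hVd ξ).differentiableAt, by rw [hder]; exact hgc.comp hVc⟩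
  · intro x y hxy
    exact hhigh (V x) (hV x) y (by rw [hTV]; exact hxy)
  · refine tendsto_order.2 ⟨fun c hc => ?_, fun c hc => ?_⟩
    · obtain ⟨v, hv1, hv2⟩ := exists_between (max_lt hc hlt)
      have hv : v ∈ Set.Ioo uplus uminus := ⟨(le_max_right _ _).trans_lt hv1, hv2⟩
      filter_upwards [Iio_mem_atBot (T v)] with η hη
      exact ((le_max_left _ _).trans_lt hv1).trans (hlow v hv η hη)
    · exact Eventually.of_forall fun η => (hV η).2.trans hc
  · refine tendsto_order.2 ⟨fun c hc => ?_, fun c hc => ?_⟩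
    · exact Eventually.of_forall fun η => hc.trans (hV η).1
    · obtain ⟨v, hv1, hv2⟩ := exists_between (lt_min hc hlt)
      have hv : v ∈ Set.Ioo uplus uminus := ⟨hv1, hv2.trans_le (min_le_right _ _)⟩
      filter_upwards [Ioi_mem_atTop (T v)] with η hη
      exact (hhigh v hv η hη).trans (hv2.trans_le (min_le_left _ _))
end

section
/- Let λ : ℝ → ℝ be Lipschitz with Lipschitz constant K, ε > 0, τ ∈ ℝ, and let χ : ℝ → ℝ be continuously differentiable with χ'(t) = λ(χ(t)) for all t. For t > τ and z ∈ ℝ define G(t,z) = (4πε(t−τ))^{−1/2} exp(−(z − χ(t))²/(4ε(t−τ))). Then for every T > τ: ∫_τ^T ∫_ℝ |∂_t G + λ(z) ∂_z G − ε ∂_z² G| dz dt ≤ K (T − τ). -/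
open Real Set

open MeasureTheory ProbabilityTheory in
lemma second_moment_aux (m v : ℝ) (hv : 0 < v) :
    ∫ z : ℝ, (z - m) ^ 2 * (Real.exp (-(z - m) ^ 2 / (2 * v)) / Real.sqrt (2 * π * v)) = v := by
  lift v to NNReal using hv.le
  have hne : v ≠ 0 := by
    rintro rfl
    simp at hv
  have h := variance_id_gaussianReal (μ := m) (v := v)
  rw [variance_eq_integral (by fun_prop)] at h
  have h0 : ∫ x, id x ∂(gaussianReal m v) = m := integral_id_gaussianReal
  rw [h0, integral_gaussianReal_eq_integral_smul hne] at h
  refine Eq.trans ?_ h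
  congr 1
  ext z
  simp only [gaussianPDFReal, smul_eq_mul, id_eq]
  rw [div_eq_mul_inv]
  ring

open MeasureTheory in
lemma inner_bound_aux (m v K : ℝ) (hv : 0 < v) (f : ℝ → ℝ)
    (hf : ∀ z, |f z| ≤ K / v * ((z - m) ^ 2 *
      (Real.exp (-(z - m) ^ 2 / (2 * v)) / Real.sqrt (2 * π * v)))) :
    ∫ z : ℝ, |f z| ≤ K := by
  have h := second_moment_aux m v hv
  have hi := Integrable.of_integral_ne_zero (h.trans_ne hv.ne')
  calc ∫ z : ℝ, |f z| ≤ ∫ z : ℝ, K / v * ((z - m) ^ 2 *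
      (Real.exp (-(z - m) ^ 2 / (2 * v)) / Real.sqrt (2 * π * v))) :=
        integral_mono_of_nonneg (Filter.Eventually.of_forall fun z => abs_nonneg _)
          (hi.const_mul _) (Filter.Eventually.of_forall hf)
    _ = K := by rw [integral_const_mul, h]; field_simp

lemma deriv_z_aux (m a c z : ℝ) :
    HasDerivAt (fun y => Real.exp (-(y - m) ^ 2 / a) / c)
      (-(2 * (z - m)) / a * (Real.exp (-(z - m) ^ 2 / a) / c)) z := by
  have h1 : HasDerivAt (fun y : ℝ => -(y - m) ^ 2 / a) (-(2 * (z - m)) / a) z := by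
    have := ((((hasDerivAt_id z).sub_const m).pow 2).neg).div_const a
    simpa using this
  refine (h1.exp.div_const c).congr_deriv ?_
  ring

lemma deriv_zz_aux (m a c z : ℝ) :
    HasDerivAt (fun y => -(2 * (y - m)) / a * (Real.exp (-(y - m) ^ 2 / a) / c))
      ((-2 / a + (2 * (z - m) / a) ^ 2) * (Real.exp (-(z - m) ^ 2 / a) / c)) z := by
  have h1 : HasDerivAt (fun y : ℝ => -(2 * (y - m)) / a) (-2 / a) z := by
    have := ((((hasDerivAt_id z).sub_const m).const_mul 2).neg).div_const a
    simpa using this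
  refine (h1.mul (deriv_z_aux m a c z)).congr_deriv ?_
  ring

lemma deriv_t_aux (χ : ℝ → ℝ) (l ε τ t z : ℝ) (hε : 0 < ε) (ht : τ < t)
    (hχ : HasDerivAt χ l t) :
    HasDerivAt (fun s => Real.exp (-(z - χ s) ^ 2 / (4 * ε * (s - τ))) /
        Real.sqrt (4 * π * ε * (s - τ)))
      ((2 * (z - χ t) * l / (4 * ε * (t - τ))
        + 4 * ε * (z - χ t) ^ 2 / (4 * ε * (t - τ)) ^ 2 - 1 / (2 * (t - τ))) *
        (Real.exp (-(z - χ t) ^ 2 / (4 * ε * (t - τ))) /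
        Real.sqrt (4 * π * ε * (t - τ)))) t := by
  have hs : 0 < t - τ := sub_pos.2 ht
  have hp : 0 < 4 * π * ε * (t - τ) := by positivity
  have hl : HasDerivAt (fun s : ℝ => 4 * ε * (s - τ)) (4 * ε) t := by
    simpa using ((hasDerivAt_id t).sub_const τ).const_mul (4 * ε)
  have hl2 : HasDerivAt (fun s : ℝ => 4 * π * ε * (s - τ)) (4 * π * ε) t := by
    simpa using ((hasDerivAt_id t).sub_const τ).const_mul (4 * π * ε)
  have hn : HasDerivAt (fun s : ℝ => -(z - χ s) ^ 2) (2 * (z - χ t) * l) t := by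
    refine ((hχ.const_sub z).pow 2).neg.congr_deriv ?_
    simp
  have he := (hn.div hl (by positivity)).exp
  have hq := hl2.sqrt hp.ne'
  have hsq : 0 < Real.sqrt (4 * π * ε * (t - τ)) := Real.sqrt_pos.2 hp
  refine (he.div hq hsq.ne').congr_deriv ?_
  have h2 := Real.sq_sqrt hp.le
  simp only [Pi.div_apply]
  generalize Real.exp (-(z - χ t) ^ 2 / (4 * ε * (t - τ))) = E
  generalize Real.sqrt (4 * π * ε * (t - τ)) = S at *
  have h3 : 1 / (2 * (t - τ)) = 4 * π * ε / (2 * S ^ 2) := by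
    rw [h2]
    field_simp
  rw [h3]
  field_simp
  ring

/-- `L¹` bound, linear in `T − τ` and uniform in `ε`, for the error committed by the
Gaussian kernel transported along a characteristic `χ' = λ(χ)` as an approximate
Green's function of `∂_t + λ(z) ∂_z − ε ∂_z²`, when `λ` is `K`-Lipschitz. -/
theorem gaussian_along_characteristic_L1_error (lam : ℝ → ℝ) (K : NNReal)
    (hlam : LipschitzWith K lam)
    (ε : ℝ) (hε : 0 < ε) (τ : ℝ)
    (χ : ℝ → ℝ) (hχ : ∀ t : ℝ, HasDerivAt χ (lam (χ t)) t)
    (G : ℝ → ℝ → ℝ)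
    (hG : ∀ t z : ℝ, G t z =
      Real.exp (-(z - χ t) ^ 2 / (4 * ε * (t - τ))) / Real.sqrt (4 * π * ε * (t - τ))) :
    ∀ T : ℝ, τ < T →
      (∫ t in Ioc τ T, ∫ z : ℝ,
          |deriv (fun s => G s z) t + lam z * deriv (fun y => G t y) z
            - ε * deriv (fun y => deriv (fun y' => G t y') y) z|)
        ≤ (K : ℝ) * (T - τ) := by
  intro T hT
  have key : ∀ t ∈ Ioc τ T, ‖∫ z : ℝ,
          |deriv (fun s => G s z) t + lam z * deriv (fun y => G t y) z
            - ε * deriv (fun y => deriv (fun y' => G t y') y) z|‖ ≤ (K : ℝ) := by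
    intro t ht
    have hs : 0 < t - τ := sub_pos.2 ht.1
    rw [Real.norm_of_nonneg (MeasureTheory.integral_nonneg fun z => abs_nonneg _)]
    refine inner_bound_aux (χ t) (2 * ε * (t - τ)) K (by positivity) _ fun z => ?_
    have hGt : (fun y => G t y) = fun y => Real.exp (-(y - χ t) ^ 2 / (4 * ε * (t - τ))) /
        Real.sqrt (4 * π * ε * (t - τ)) := funext fun y => hG t y
    have hGs : (fun s => G s z) = fun s => Real.exp (-(z - χ s) ^ 2 / (4 * ε * (s - τ))) /
        Real.sqrt (4 * π * ε * (s - τ)) := funext fun s => hG s z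
    have hd : (fun y => deriv (fun y' => G t y') y) =
        fun y => -(2 * (y - χ t)) / (4 * ε * (t - τ)) *
          (Real.exp (-(y - χ t) ^ 2 / (4 * ε * (t - τ))) /
            Real.sqrt (4 * π * ε * (t - τ))) := by
      rw [hGt]
      exact funext fun y => (deriv_z_aux (χ t) _ _ y).deriv
    rw [hd, (deriv_zz_aux _ _ _ z).deriv, hGs, hGt, (deriv_z_aux _ _ _ z).deriv,
      (deriv_t_aux χ _ ε τ t z hε ht.1 (hχ t)).deriv,
      show 2 * (2 * ε * (t - τ)) = 4 * ε * (t - τ) by ring,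
      show 2 * π * (2 * ε * (t - τ)) = 4 * π * ε * (t - τ) by ring]
    have hg : 0 ≤ Real.exp (-(z - χ t) ^ 2 / (4 * ε * (t - τ))) /
        Real.sqrt (4 * π * ε * (t - τ)) := by positivity
    generalize Real.exp (-(z - χ t) ^ 2 / (4 * ε * (t - τ))) /
        Real.sqrt (4 * π * ε * (t - τ)) = g at *
    have hL : |lam z - lam (χ t)| ≤ K * |z - χ t| := by
      simpa [Real.dist_eq] using hlam.dist_le_mul z (χ t)
    have e : (2 * (z - χ t) * lam (χ t) / (4 * ε * (t - τ))
        + 4 * ε * (z - χ t) ^ 2 / (4 * ε * (t - τ)) ^ 2 - 1 / (2 * (t - τ))) * g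
        + lam z * (-(2 * (z - χ t)) / (4 * ε * (t - τ)) * g)
        - ε * ((-2 / (4 * ε * (t - τ)) + (2 * (z - χ t) / (4 * ε * (t - τ))) ^ 2) * g)
        = -((lam z - lam (χ t)) * (z - χ t) * (g / (2 * ε * (t - τ)))) := by
      field_simp
      ring
    rw [e, abs_neg, abs_mul, abs_mul,
      abs_of_nonneg (show 0 ≤ g / (2 * ε * (t - τ)) by positivity)]
    calc |lam z - lam (χ t)| * |z - χ t| * (g / (2 * ε * (t - τ)))
        ≤ (K * |z - χ t|) * |z - χ t| * (g / (2 * ε * (t - τ))) := by gcongr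
      _ = K * |z - χ t| ^ 2 * (g / (2 * ε * (t - τ))) := by ring
      _ = _ := by rw [sq_abs]; ring
  have h := MeasureTheory.norm_setIntegral_le_of_norm_le_const (μ := MeasureTheory.volume)
    (s := Ioc τ T) (by simp) key
  rw [Real.volume_real_Ioc_of_le hT.le] at h
  exact (le_abs_self _).trans h
end
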